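/- The function G(θ) = θ − x_0(1−x_0/L)Σ_{i=1}^N f(e_i+θ) is continuous and strictly increasing on [0,∞), tends to +∞ as θ→+∞, satisfies G(0)<0 and G(ε_S−e_1)=ε_S−e_1>0; consequently the equation θ = x_0(1−x_0/L)Σ_{i=1}^N f(e_i+θ) has exactly one nonnegative solution θ, and this solution lies in the open interval (0, ε_S−e_1). In particular Σ_{i=1}^N f(e_i+θ) > 0. -/

import Mathlib

open MeasureTheory Filter

theorem nonlinear_equation_unique_solution
    (L : ℝ) (hL : 0 < L)
    (x₀ : ℝ) (hx₀ : x₀ ∈ Set.Ioo 0 L)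
    (εS : ℝ) (hεS : εS < 0)
    (f : ℝ → ℝ) (hfsmooth : ContDiff ℝ (⊤ : ℕ∞) f)
    (hfpos : ∀ x, x < εS → 0 < f x) (hfzero : ∀ x, εS ≤ x → f x = 0)
    (hfdec : ∀ x y, x ≤ y → f y ≤ f x)
    (N : ℕ) (hN : 0 < N) (e : ℕ → ℝ)
    (heneg : ∀ i, i < N → e i < 0)
    (hemono : ∀ i j, i < j → j < N → e i < e j)
    (he1S : e 0 < εS)
    (G : ℝ → ℝ)
    (hG : G = fun θ => θ - x₀ * (1 - x₀ / L) * ∑ i ∈ Finset.range N, f (e i + θ)) :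
    ContinuousOn G (Set.Ici 0) ∧
    StrictMonoOn G (Set.Ici 0) ∧
    Filter.Tendsto G Filter.atTop Filter.atTop ∧
    G 0 < 0 ∧
    (G (εS - e 0) = εS - e 0 ∧ 0 < εS - e 0) ∧
    (∃! θ : ℝ, 0 ≤ θ ∧ θ = x₀ * (1 - x₀ / L) * ∑ i ∈ Finset.range N, f (e i + θ)) ∧
    (∀ θ : ℝ, 0 ≤ θ → θ = x₀ * (1 - x₀ / L) * ∑ i ∈ Finset.range N, f (e i + θ) →
      θ ∈ Set.Ioo 0 (εS - e 0) ∧ 0 < ∑ i ∈ Finset.range N, f (e i + θ)) := by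
  obtain ⟨hx₀pos, hx₀L⟩ := hx₀
  have hc : 0 < x₀ * (1 - x₀ / L) :=
    mul_pos hx₀pos (sub_pos.2 ((div_lt_one hL).2 hx₀L))
  set c := x₀ * (1 - x₀ / L)
  set S : ℝ → ℝ := fun θ => ∑ i ∈ Finset.range N, f (e i + θ)
  have hf_nonneg : ∀ x, 0 ≤ f x := fun x =>
    (lt_or_ge x εS).elim (fun h => (hfpos x h).le) (fun h => (hfzero x h).ge)
  have he0 : ∀ i, i < N → e 0 ≤ e i := fun i hi => by
    rcases Nat.eq_zero_or_pos i with rfl | h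
    · exact le_rfl
    · exact (hemono 0 i h hi).le
  have hSanti : Antitone S := fun a b hab =>
    Finset.sum_le_sum fun i _ => hfdec _ _ (by linarith)
  have hSpos : ∀ θ, θ < εS - e 0 → 0 < S θ := fun θ hθ =>
    Finset.sum_pos' (fun i _ => hf_nonneg _)
      ⟨0, Finset.mem_range.2 hN, hfpos _ (by linarith)⟩
  have hSzero : ∀ θ, εS - e 0 ≤ θ → S θ = 0 := fun θ hθ =>
    Finset.sum_eq_zero fun i hi =>
      hfzero _ (by linarith [he0 i (Finset.mem_range.1 hi)])
  have hGval : ∀ θ, G θ = θ - c * S θ := fun θ => by rw [hG]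
  have hGcont : Continuous G := by
    have := hfsmooth.continuous
    rw [hG]
    fun_prop
  have hGmono : StrictMono G := fun a b hab => by
    rw [hGval, hGval]
    linarith [mul_le_mul_of_nonneg_left (hSanti hab.le) hc.le]
  have hb : 0 < εS - e 0 := sub_pos.2 he1S
  have hG0 : G 0 < 0 := by
    rw [hGval]
    linarith [mul_pos hc (hSpos 0 hb)]
  have hGb : G (εS - e 0) = εS - e 0 := by
    rw [hGval, hSzero _ le_rfl, mul_zero, sub_zero]
  have hroot : ∀ θ, θ = c * S θ ↔ G θ = 0 := fun θ => by rw [hGval, sub_eq_zero]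
  refine ⟨hGcont.continuousOn, hGmono.strictMonoOn _, ?_, hG0, ⟨hGb, hb⟩, ?_, ?_⟩
  · refine tendsto_id.congr' ?_
    filter_upwards [eventually_ge_atTop (εS - e 0)] with θ hθ
    rw [hGval, hSzero θ hθ, mul_zero, sub_zero, id]
  · obtain ⟨θ, hθ, hGθ⟩ := intermediate_value_Icc hb.le hGcont.continuousOn
      (show (0 : ℝ) ∈ Set.Icc (G 0) (G (εS - e 0)) from ⟨hG0.le, hb.le.trans_eq hGb.symm⟩)
    exact ⟨θ, ⟨hθ.1, (hroot θ).2 hGθ⟩, fun y hy =>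
      hGmono.injective (((hroot y).1 hy.2).trans hGθ.symm)⟩
  · intro θ _ hθ
    have hGθ := (hroot θ).1 hθ
    have hlt : θ < εS - e 0 := hGmono.lt_iff_lt.1 (by rw [hGθ, hGb]; exact hb)
    exact ⟨⟨hGmono.lt_iff_lt.1 (by rw [hGθ]; exact hG0), hlt⟩, hSpos θ hlt⟩
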